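/- arXiv:1201.2592 — 3 statements merged into one kernel-verified Lean document; each statement's English description precedes it below -/
import Mathlib

section
/- Let G, H, W be rational functions: G, H strictly proper with all poles in the open left half-plane, W proper with simple poles γ₁,…,γ_p in the open left half-plane. Assume H has simple poles μ₁,…,μ_m, no pole of H coincides with a pole of W, and no pole of G(−s)W(−s) coincides with any μ_k or γ_i. Then ⟨G, H⟩_{H2(W)} := (1/2π)∫_{−∞}^{∞} G(−iω)W(−iω)W(iω)H(iω) dω = Σ_{k=1}^{m} G(−μ_k)W(−μ_k)W(μ_k)·res[H, μ_k] + Σ_{i=1}^{p} G(−γ_i)W(−γ_i)H(γ_i)·res[W, γ_i]. -/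
open MeasureTheory Complex Polynomial
open Filter Asymptotics Bornology Topology

lemma norm_comp_tendsto : Tendsto (fun ω : ℝ => I * (ω:ℂ)) (cocompact ℝ) (cobounded ℂ) := by
  rw [← tendsto_norm_atTop_iff_cobounded]
  have h : (fun ω : ℝ => ‖I * (ω:ℂ)‖) = fun ω : ℝ => ‖ω‖ := by ext; simp
  rw [h]
  exact tendsto_norm_cocompact_atTop (E := ℝ)

lemma aux_integrable (K : ℂ → ℂ) (hd : DifferentiableOn ℂ K {s | s.re ≤ 0})
    (hO : K =O[cobounded ℂ] fun s => (s⁻¹)^2) :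
    Integrable (fun ω : ℝ => K (I * ω)) := by
  have hc : Continuous (fun ω : ℝ => K (I * ω)) := by
    refine hd.continuousOn.comp_continuous (by fun_prop) ?_
    intro x; simp
  refine hc.locallyIntegrable.integrable_of_isBigO_cocompact (g := fun x : ℝ => (1 + x^2)⁻¹) ?_ ?_
  · refine (hO.comp_tendsto norm_comp_tendsto).trans ?_
    refine IsBigO.of_bound 2 ?_
    have : ∀ᶠ x : ℝ in cocompact ℝ, 1 ≤ ‖x‖ :=
      (tendsto_norm_cocompact_atTop (E := ℝ)).eventually_ge_atTop 1
    filter_upwards [this] with x hx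
    have h1 : 1 ≤ x^2 := by
      rw [← sq_abs]; exact one_le_pow₀ hx
    simp only [Function.comp, norm_pow, norm_inv, norm_mul, norm_I, one_mul, norm_real]
    rw [inv_pow, Real.norm_eq_abs, sq_abs, Real.norm_eq_abs, abs_of_pos (by positivity), ← div_eq_mul_inv, inv_eq_one_div, div_le_div_iff₀ (by positivity) (by positivity)]
    linarith
  · exact integrable_inv_one_add_sq.integrableAtFilter _

lemma aux_zero (K : ℂ → ℂ) (hd : DifferentiableOn ℂ K {s | s.re ≤ 0})
    (hO : K =O[cobounded ℂ] fun s => (s⁻¹)^2) :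
    ∫ ω : ℝ, K (I * ω) = 0 := by
  have hi := aux_integrable K hd hO
  have ht := intervalIntegral_tendsto_integral hi tendsto_neg_atTop_atBot tendsto_id
  refine tendsto_nhds_unique ht ?_
  obtain ⟨C, hC⟩ := hO.bound
  rw [← comap_norm_atTop, eventually_comap] at hC
  obtain ⟨R0, hR0⟩ := eventually_atTop.1 hC
  have hbd : ∀ s : ℂ, ∀ R : ℝ, 0 < R → R0 ≤ R → R ≤ ‖s‖ → ‖K s‖ ≤ |C| / R^2 := by
    intro s R hR hR' hs
    refine (hR0 ‖s‖ (hR'.trans hs) s rfl).trans ?_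
    rw [norm_pow, norm_inv, inv_pow, ← div_eq_mul_inv]
    gcongr
    exact le_abs_self C
  have hlim : Tendsto (fun R : ℝ => 4 * |C| / R) atTop (𝓝 0) :=
    tendsto_const_nhds.div_atTop tendsto_id
  refine squeeze_zero_norm' ?_ hlim
  filter_upwards [eventually_gt_atTop 0, eventually_ge_atTop R0] with R hR hR'
  have hrect := Complex.integral_boundary_rect_eq_zero_of_differentiableOn K (⟨-R, -R⟩ : ℂ) (⟨0, R⟩ : ℂ) (hd.mono (by
    intro s hs
    rw [mem_reProdIm, Set.uIcc_of_le (by simpa using hR.le)] at hs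
    exact hs.1.2))
  have h1 := intervalIntegral.norm_integral_le_of_norm_le_const (a := -R) (b := 0)
    (f := fun x : ℝ => K (x + (-R : ℝ) * I)) (C := |C| / R^2) (fun x _ => hbd _ R hR hR' (by
      refine le_trans ?_ (abs_im_le_norm _); simp [le_abs_self]))
  have h2 := intervalIntegral.norm_integral_le_of_norm_le_const (a := -R) (b := 0)
    (f := fun x : ℝ => K (x + (R : ℝ) * I)) (C := |C| / R^2) (fun x _ => hbd _ R hR hR' (by
      refine le_trans ?_ (abs_im_le_norm _); simp [le_abs_self]))
  have h3 := intervalIntegral.norm_integral_le_of_norm_le_const (a := -R) (b := R)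
    (f := fun x : ℝ => K ((-R : ℝ) + x * I)) (C := |C| / R^2) (fun x _ => hbd _ R hR hR' (by
      refine le_trans ?_ (abs_re_le_norm _); simp [le_abs_self]))
  simp only at hrect
  set A := ∫ x in (-R)..0, K (x + (-R : ℝ) * I)
  set B := ∫ x in (-R)..0, K (x + (R : ℝ) * I)
  set D := ∫ x in (-R)..R, K ((-R : ℝ) + x * I)
  have e : ∫ x in (-R)..R, K (((0:ℝ):ℂ) + x * I) = ∫ x in (-R)..R, K (I * x) := by
    congr 1; ext x; congr 1; simp [mul_comm]
  rw [e] at hrect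
  simp only [id]
  set E := ∫ x in (-R)..R, K (I * x)
  have hE : I * E = B - A + I * D := by
    simp only [smul_eq_mul] at hrect
    linear_combination hrect
  have : ‖E‖ = ‖I * E‖ := by simp
  rw [this, hE]
  have h4 : ‖B - A + I * D‖ ≤ ‖B‖ + ‖A‖ + ‖D‖ := by
    refine (norm_add_le _ _).trans ?_
    have := norm_sub_le B A
    simp; linarith
  have a1 : |0 - -R| = R := by simp [abs_of_pos hR]
  have a2 : |R - -R| = 2 * R := by rw [abs_of_pos (by linarith)]; ring
  rw [a1] at h1 h2
  rw [a2] at h3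
  have : 4 * |C| / R = |C|/R^2 * R + |C|/R^2*R + |C|/R^2*(2*R) := by field_simp; ring
  linarith

lemma inv_sub_isBigO (a : ℂ) : (fun s : ℂ => (s - a)⁻¹) =O[cobounded ℂ] fun s => s⁻¹ := by
  refine IsBigO.inv_rev ?_ ?_
  · refine IsBigO.of_bound 2 ?_
    filter_upwards [(tendsto_norm_cobounded_atTop (E := ℂ)).eventually_ge_atTop (2 * ‖a‖)] with s hs
    have := norm_sub_norm_le s a
    linarith
  · filter_upwards [(tendsto_norm_cobounded_atTop (E := ℂ)).eventually_gt_atTop (‖a‖)] with s hs h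
    rw [h, norm_zero] at hs
    exact absurd hs (not_lt.2 (norm_nonneg a))

lemma core_base (a : ℂ) (ha : a.re < 0) : ∫ ω : ℝ, ((a + (starRingEnd ℂ) a) / (I * ω + (starRingEnd ℂ) a)) / (I * ω - a) = 2 * Real.pi := by
  have h0 : -a.re ≠ 0 := by linarith
  have h : ∀ ω : ℝ, ((a + (starRingEnd ℂ) a) / (I * ω + (starRingEnd ℂ) a)) / (I * ω - a)
      = ((2 * ((-a.re)⁻¹ * (1 + ((ω - a.im)/(-a.re))^2)⁻¹) : ℝ) : ℂ) := by
    intro ω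
    have e1 : (a + (starRingEnd ℂ) a) = ((2 * a.re : ℝ):ℂ) := by apply Complex.ext <;> simp; ring
    have e2 : (I * ω + (starRingEnd ℂ) a) * (I * ω - a) = ((-((ω - a.im)^2 + a.re^2) : ℝ) : ℂ) := by
      apply Complex.ext
      · rw [ofReal_re]; simp; ring
      · rw [ofReal_im]; simp; ring
    rw [div_div, e1, e2, ← ofReal_div]
    congr 1
    have h00 : a.re ≠ 0 := ha.ne
    have : 0 < (ω - a.im)^2 + a.re^2 := by positivity
    have : 0 < a.re^2 + (ω - a.im)^2 := by positivity
    field_simp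
    try ring
  simp_rw [h]
  rw [integral_complex_ofReal, integral_const_mul, integral_const_mul,
    integral_sub_right_eq_self (fun x : ℝ => (1 + (x / (-a.re))^2)⁻¹) a.im,
    Measure.integral_comp_div (fun x : ℝ => (1 + x^2)⁻¹), integral_univ_inv_one_add_sq,
    abs_of_pos (by linarith)]
  simp only [smul_eq_mul]
  rw [inv_mul_cancel_left₀ h0]
  simp

lemma core (f : ℂ → ℂ) (hd : DifferentiableOn ℂ f {s | s.re ≤ 0})
    (hO : f =O[cobounded ℂ] fun s => s⁻¹) (a : ℂ) (ha : a.re < 0) :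
    Integrable (fun ω : ℝ => f (I * ω) / (I * ω - a)) ∧
    ∫ ω : ℝ, f (I * ω) / (I * ω - a) = 2 * Real.pi * f a := by
  have hnz : ∀ s : ℂ, s.re ≤ 0 → s + (starRingEnd ℂ) a ≠ 0 := by
    intro s hs h
    have := congrArg re h
    simp at this; linarith
  set f0 : ℂ → ℂ := fun s => (a + (starRingEnd ℂ) a) / (s + (starRingEnd ℂ) a) with hf0
  have hf0a : f0 a = 1 := div_self (hnz a ha.le)
  have hd0 : DifferentiableOn ℂ f0 {s | s.re ≤ 0} := by
    intro s hs
    have h1 : DifferentiableAt ℂ (fun s : ℂ => s + (starRingEnd ℂ) a) s := by fun_prop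
    exact ((differentiableAt_const (a + (starRingEnd ℂ) a)).fun_div h1 (hnz s hs)).differentiableWithinAt
  have hO0 : f0 =O[cobounded ℂ] fun s => s⁻¹ := by
    simp only [hf0, div_eq_mul_inv]
    refine IsBigO.const_mul_left ?_ _
    simpa using inv_sub_isBigO (-(starRingEnd ℂ) a)
  have hnhd : {s : ℂ | s.re ≤ 0} ∈ 𝓝 a :=
    Filter.mem_of_superset ((isOpen_lt continuous_re continuous_const).mem_nhds ha)
      (fun s (hs : s.re < 0) => hs.le)
  have key : ∀ g : ℂ → ℂ, DifferentiableOn ℂ g {s | s.re ≤ 0} → (g =O[cobounded ℂ] fun s => s⁻¹) →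
      g a = 0 → Integrable (fun ω : ℝ => g (I * ω) / (I * ω - a)) ∧
        ∫ ω : ℝ, g (I * ω) / (I * ω - a) = 0 := by
    intro g hg hgO hga
    have hK := (Complex.differentiableOn_dslope hnhd).2 hg
    have heq : ∀ s, s ≠ a → dslope g a s = g s / (s - a) := by
      intro s hs
      rw [dslope_of_ne _ hs, slope_def_field, hga, sub_zero]
    have hKO : dslope g a =O[cobounded ℂ] fun s => (s⁻¹)^2 := by
      have h1 := hgO.mul (inv_sub_isBigO a)
      refine (h1.congr' ?_ ?_)
      · filter_upwards [(tendsto_norm_cobounded_atTop (E := ℂ)).eventually_gt_atTop (‖a‖)] with s hs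
        rw [heq, div_eq_mul_inv]
        rintro rfl; exact lt_irrefl _ hs
      · exact Eventually.of_forall (fun s => (sq _).symm)
    have hfun : (fun ω : ℝ => g (I * ω) / (I * ω - a)) = fun ω : ℝ => dslope g a (I * ω) := by
      ext ω
      rw [heq]
      intro h
      have := congrArg re h
      simp at this; linarith
    rw [hfun]
    exact ⟨aux_integrable _ hK hKO, aux_zero _ hK hKO⟩
  obtain ⟨k1, k2⟩ := key (fun s => f s - f a * f0 s) (hd.sub (hd0.const_mul _))
    (hO.sub (hO0.const_mul_left _)) (by simp [hf0a])
  have hb := core_base a ha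
  have hbi : Integrable (fun ω : ℝ => f0 (I * ω) / (I * ω - a)) := by
    by_contra hcon
    have : ∫ ω : ℝ, f0 (I * ω) / (I * ω - a) = 0 := integral_undef hcon
    rw [hb] at this
    simp [Real.pi_ne_zero] at this
  have hsplit : (fun ω : ℝ => f (I * ω) / (I * ω - a)) = fun ω : ℝ =>
      (f (I * ω) - f a * f0 (I * ω)) / (I * ω - a) + f a * (f0 (I * ω) / (I * ω - a)) := by
    ext ω; ring
  rw [hsplit]
  refine ⟨k1.add (hbi.const_mul _), ?_⟩
  rw [integral_add k1 (hbi.const_mul _), k2, integral_const_mul, hb]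
  ring

lemma poly_isBigO (P Q : ℂ[X]) (hdeg : P.degree < Q.degree) :
    (fun s => P.eval s / Q.eval s) =O[cobounded ℂ] fun s => s⁻¹ := by
  by_cases hP : P = 0
  · simp [hP, isBigO_zero]
  have hQ : Q ≠ 0 := by rintro rfl; simp at hdeg
  have hlt := (natDegree_lt_natDegree_iff hP).2 hdeg
  have hlim : ∀ p : ℂ[X], Tendsto (fun s : ℂ => p.reverse.eval s⁻¹) (cobounded ℂ) (𝓝 p.leadingCoeff) := by
    intro p
    have := (p.reverse.continuous.tendsto 0).comp (tendsto_inv₀_cobounded (α := ℂ))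
    rwa [← coeff_zero_eq_eval_zero, coeff_zero_reverse] at this
  have heq : ∀ p : ℂ[X], ∀ s : ℂ, s ≠ 0 → p.eval s = p.reverse.eval s⁻¹ * s ^ p.natDegree := by
    intro p s hs
    letI := invertibleOfNonzero hs
    have := eval₂_reverse_mul_pow (RingHom.id ℂ) s p
    simpa [eval₂_id, invOf_eq_inv] using this.symm
  have h1 := (((hlim P).div (hlim Q) (leadingCoeff_ne_zero.2 hQ)).isBigO_one ℂ).mul
    (isBigO_refl (fun s : ℂ => s⁻¹) (cobounded ℂ))
  have h2 : (fun s : ℂ => (s⁻¹)^(Q.natDegree - P.natDegree - 1)) =O[cobounded ℂ] (fun _ => (1:ℂ)) :=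
    ((tendsto_inv₀_cobounded (α := ℂ)).pow _).isBigO_one ℂ
  have h3 := h1.mul h2
  have h4 : (fun s : ℂ => (P.reverse.eval s⁻¹ / Q.reverse.eval s⁻¹ * s⁻¹) * (s⁻¹)^(Q.natDegree - P.natDegree - 1)) =O[cobounded ℂ] fun s => s⁻¹ := by
    rw [← isBigO_norm_right] 
    refine h3.norm_right.congr_right ?_
    intro s; simp
  refine h4.congr' ?_ EventuallyEq.rfl
  filter_upwards [(tendsto_norm_cobounded_atTop (E := ℂ)).eventually_gt_atTop 0] with s hs
  have hs0 : s ≠ 0 := norm_pos_iff.1 hs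
  rw [heq P s hs0, heq Q s hs0]
  obtain ⟨d, hd⟩ := Nat.exists_eq_add_of_lt hlt
  rw [hd, show P.natDegree + d + 1 - P.natDegree - 1 = d by omega]
  rw [inv_pow]
  by_cases hz : Q.reverse.eval s⁻¹ = 0
  · simp [hz]
  field_simp
  ring

lemma partial_frac {m p : ℕ} (mu : Fin m → ℂ) (gam : Fin p → ℂ) (ψ : Fin m → ℂ) (ρ : Fin p → ℂ)
    (winf : ℂ) (hHW : ∀ k i, mu k ≠ gam i) (s : ℂ) (h1 : ∀ k, s - mu k ≠ 0) (h2 : ∀ i, s - gam i ≠ 0) :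
    (winf + ∑ i, ρ i / (s - gam i)) * (∑ k, ψ k / (s - mu k)) =
    (∑ k, (winf + ∑ i, ρ i / (mu k - gam i)) * ψ k / (s - mu k)) +
      ∑ i, (∑ k, ψ k / (gam i - mu k)) * ρ i / (s - gam i) := by
  have e : ∀ i k, ρ i / (s - gam i) * (ψ k / (s - mu k)) =
      ρ i / (mu k - gam i) * ψ k / (s - mu k) + ψ k / (gam i - mu k) * ρ i / (s - gam i) := by
    intro i k
    have := h1 k
    have := h2 i
    have a1 : mu k - gam i ≠ 0 := sub_ne_zero.2 (hHW k i)
    have a2 : gam i - mu k = -(mu k - gam i) := by ring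
    rw [a2]
    field_simp
    ring
  simp_rw [add_mul, add_div, Finset.sum_add_distrib, Finset.mul_sum, Finset.sum_mul, Finset.sum_div, e,
    Finset.sum_add_distrib]
  rw [add_assoc]
  congr 1
  · exact Finset.sum_congr rfl fun k _ => by ring
  · congr 1
    rw [Finset.sum_comm]

/-- Weighted H2 inner product residue formula (Lemma `innerprodresweight`, simple
pole case): with `G` strictly proper rational and stable, `H(s) = Σₖ ψₖ/(s-μₖ)`
with simple stable poles, `W(s) = w∞ + Σᵢ ρᵢ/(s-γᵢ)` proper with simple stable
poles, no common poles of `H` and `W`, and no pole of `G(-s)W(-s)` coinciding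
with any `μₖ` or `γᵢ`:
`⟨G,H⟩_{H2(W)} = Σₖ G(-μₖ)W(-μₖ)W(μₖ)·res[H,μₖ] + Σᵢ G(-γᵢ)W(-γᵢ)H(γᵢ)·res[W,γᵢ]`. -/
theorem weighted_h2_inner_product_residue_formula
    {m p : ℕ} (mu : Fin m → ℂ) (gam : Fin p → ℂ) (ψ : Fin m → ℂ) (ρ : Fin p → ℂ)
    (winf : ℂ) (P Q : Polynomial ℂ)
    (G H W : ℂ → ℂ)
    (hG : G = fun s => P.eval s / Q.eval s)
    (hH : H = fun s => ∑ k, ψ k / (s - mu k))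
    (hW : W = fun s => winf + ∑ i, ρ i / (s - gam i))
    (hQ : Q ≠ 0) (hdeg : P.degree < Q.degree)
    (hQstable : ∀ z, Q.IsRoot z → z.re < 0)
    (hmu : ∀ k, (mu k).re < 0) (hgam : ∀ i, (gam i).re < 0)
    (hmu_inj : Function.Injective mu) (hgam_inj : Function.Injective gam)
    (hHW : ∀ k i, mu k ≠ gam i)
    (hGpoles : ∀ z, Q.IsRoot z → (∀ k, -z ≠ mu k) ∧ (∀ i, -z ≠ gam i))
    (hWrefl : ∀ i k, -(gam i) ≠ mu k)
    (hWrefl' : ∀ i j, -(gam i) ≠ gam j) :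
    (2 * (Real.pi : ℂ))⁻¹ *
        ∫ ω : ℝ, G (-(Complex.I * (ω : ℂ))) * W (-(Complex.I * (ω : ℂ))) *
          W (Complex.I * (ω : ℂ)) * H (Complex.I * (ω : ℂ))
      = (∑ k, G (-(mu k)) * W (-(mu k)) * W (mu k) * ψ k)
        + ∑ i, G (-(gam i)) * W (-(gam i)) * H (gam i) * ρ i := by
  have hQne : ∀ s : ℂ, 0 ≤ s.re → Q.eval s ≠ 0 := fun s hs h => by
    have := hQstable s h
    linarith
  have hgne : ∀ s : ℂ, 0 ≤ s.re → ∀ i, s - gam i ≠ 0 := fun s hs i h => by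
    have h' := congrArg re h
    have := hgam i
    simp at h'
    linarith
  have hmne : ∀ s : ℂ, 0 ≤ s.re → ∀ k, s - mu k ≠ 0 := fun s hs i h => by
    have h' := congrArg re h
    have := hmu i
    simp at h'
    linarith
  set F : ℂ → ℂ := fun s => G (-s) * W (-s) with hF
  have hdF : DifferentiableOn ℂ F {s | s.re ≤ 0} := by
    intro s hs
    have hs' : 0 ≤ (-s).re := by simpa using hs
    refine DifferentiableAt.differentiableWithinAt ?_
    simp only [hF, hG, hW]
    refine DifferentiableAt.mul ?_ ?_
    · refine DifferentiableAt.div ?_ ?_ (hQne _ hs')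
      · exact P.differentiable.differentiableAt.comp s differentiableAt_id.neg
      · exact Q.differentiable.differentiableAt.comp s differentiableAt_id.neg
    · refine (differentiableAt_const _).add ?_
      refine DifferentiableAt.fun_sum fun i _ => ?_
      exact (differentiableAt_const _).div (by fun_prop) (hgne _ hs' i)
  have hneg : Tendsto (fun s : ℂ => -s) (cobounded ℂ) (cobounded ℂ) := by
    rw [← tendsto_norm_atTop_iff_cobounded]
    simpa using tendsto_norm_cobounded_atTop (E := ℂ)
  have hOF : F =O[cobounded ℂ] fun s => s⁻¹ := by
    have hG1 : G =O[cobounded ℂ] fun s => s⁻¹ := by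
      rw [hG]; exact poly_isBigO P Q hdeg
    have hW1 : W =O[cobounded ℂ] fun _ => (1:ℂ) := by
      rw [hW]
      refine (isBigO_const_const _ one_ne_zero _).add ?_
      refine IsBigO.fun_sum fun i _ => ?_
      simp only [div_eq_mul_inv]
      refine IsBigO.const_mul_left ?_ _
      exact (inv_sub_isBigO _).trans ((tendsto_inv₀_cobounded (α := ℂ)).isBigO_one ℂ)
    have := (hG1.mul hW1).comp_tendsto hneg
    refine (this.norm_right.congr_right (g₂ := fun s => ‖s⁻¹‖) ?_).of_norm_right
    intro s; simp
  have hcm := fun k => core F hdF hOF (mu k) (hmu k)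
  have hcg := fun i => core F hdF hOF (gam i) (hgam i)
  have hint : ∀ ω : ℝ, G (-(Complex.I * (ω : ℂ))) * W (-(Complex.I * (ω : ℂ))) *
          W (Complex.I * (ω : ℂ)) * H (Complex.I * (ω : ℂ)) =
      (∑ k, W (mu k) * ψ k * (F (I * ω) / (I * ω - mu k))) +
      ∑ i, H (gam i) * ρ i * (F (I * ω) / (I * ω - gam i)) := by
    intro ω
    have hp := partial_frac mu gam ψ ρ winf hHW (I * ω) (hmne _ (by simp)) (hgne _ (by simp))
    have hp' : W (I * ω) * H (I * ω) = (∑ k, W (mu k) * ψ k / (I * ω - mu k)) +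
      ∑ i, H (gam i) * ρ i / (I * ω - gam i) := by
      simp only [hW, hH]; exact hp
    have : F (I * ω) = G (-(Complex.I * (ω : ℂ))) * W (-(Complex.I * (ω : ℂ))) := rfl
    rw [← this, mul_assoc, hp', mul_add, Finset.mul_sum, Finset.mul_sum]
    congr 1
    · exact Finset.sum_congr rfl fun k _ => by ring
    · exact Finset.sum_congr rfl fun k _ => by ring
  simp_rw [hint]
  rw [integral_add (integrable_finsetSum _ fun k _ => (hcm k).1.const_mul _)
    (integrable_finsetSum _ fun i _ => (hcg i).1.const_mul _),
    integral_finsetSum _ fun k _ => (hcm k).1.const_mul _,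
    integral_finsetSum _ fun i _ => (hcg i).1.const_mul _]
  simp_rw [integral_const_mul, (hcm _).2, (hcg _).2]
  have hpi : (Real.pi : ℂ) ≠ 0 := by exact_mod_cast Real.pi_ne_zero
  rw [mul_add, Finset.mul_sum, Finset.mul_sum]
  congr 1
  · refine Finset.sum_congr rfl fun k _ => ?_
    simp only [hF]
    field_simp
  · refine Finset.sum_congr rfl fun k _ => ?_
    simp only [hF]
    field_simp
end

section
/- Let G be strictly proper rational with simple poles λ₁,…,λ_n in the open left half-plane, W proper rational with simple poles γ₁,…,γ_p in the open left half-plane (all relevant points distinct), and let μ be in the open left half-plane, distinct from all λᵢ, γₖ, −λᵢ, −γₖ. Define F = 𝔉[G] by F(s) = G(s)W(s)W(−s) + Σ_k G(−γ_k)W(−γ_k)·res[W, γ_k]/(s + γ_k). Then ⟨G, 1/(s − μ)⟩_{H2(W)} = F(−μ). -/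
open MeasureTheory Complex

def HInt (f : ℝ → ℂ) (v : ℂ) : Prop := Integrable f ∧ ∫ ω, f ω = v

lemma HInt.add {f g : ℝ → ℂ} {v w : ℂ} (hf : HInt f v) (hg : HInt g w) :
    HInt (fun ω => f ω + g ω) (v + w) :=
  ⟨hf.1.add hg.1, by rw [integral_add hf.1 hg.1, hf.2, hg.2]⟩

lemma HInt.mul {f : ℝ → ℂ} {v : ℂ} (c : ℂ) (hf : HInt f v) :
    HInt (fun ω => c * f ω) (c * v) :=
  ⟨hf.1.const_mul c, by rw [integral_const_mul, hf.2]⟩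

lemma HInt.sum {ι : Type} (s : Finset ι) {f : ι → ℝ → ℂ} {v : ι → ℂ}
    (hf : ∀ i, HInt (f i) (v i)) :
    HInt (fun ω => ∑ i ∈ s, f i ω) (∑ i ∈ s, v i) :=
  ⟨integrable_finsetSum s (fun i _ => (hf i).1), by
    rw [integral_finsetSum s (fun i _ => (hf i).1)]
    exact Finset.sum_congr rfl fun i _ => (hf i).2⟩

lemma re_u {a : ℂ} (ha : a.re < 0) (ω : ℝ) : 0 < (I * (ω : ℂ) - a).re := by simp [ha]
lemma re_v {a : ℂ} (ha : a.re < 0) (ω : ℝ) : 0 < (-(I * (ω : ℂ)) - a).re := by simp [ha]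
lemma ne_of_re_pos' {z : ℂ} (h : 0 < z.re) : z ≠ 0 := by
  rintro rfl; simp at h

lemma memLp_u {a : ℂ} (ha : a.re < 0) :
    MemLp (fun ω : ℝ => (I * (ω : ℂ) - a)⁻¹) 2 := by
  have hc : Continuous (fun ω : ℝ => (I * (ω : ℂ) - a)⁻¹) :=
    Continuous.inv₀ (by fun_prop) (fun ω => ne_of_re_pos' (re_u ha ω))
  rw [memLp_two_iff_integrable_sq_norm hc.aestronglyMeasurable]
  have h := ((integrable_inv_one_add_sq.comp_div (g := fun x : ℝ => (1 + x ^ 2)⁻¹)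
    ha.ne).comp_sub_right a.im).const_mul ((a.re ^ 2)⁻¹)
  refine h.congr (Filter.Eventually.of_forall fun ω => ?_)
  have h1 : ‖I * (ω : ℂ) - a‖ ^ 2 = a.re ^ 2 + (ω - a.im) ^ 2 := by
    rw [← Complex.normSq_eq_norm_sq, Complex.normSq_apply]; simp; ring
  simp only [norm_inv, inv_pow, h1]
  rw [← mul_inv]
  congr 1
  have := ha.ne
  field_simp

lemma memLp_v {a : ℂ} (ha : a.re < 0) :
    MemLp (fun ω : ℝ => (-(I * (ω : ℂ)) - a)⁻¹) 2 := by
  have h := (memLp_u ha).comp_measurePreserving (Measure.measurePreserving_neg (volume : Measure ℝ))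
  convert h using 2 with ω
  simp

lemma log_lim {z : ℂ} (hz : z ∈ slitPlane) (a : ℂ) :
    Filter.Tendsto (fun ω : ℝ => log (z * ω - a) - log (ω : ℂ)) Filter.atTop (nhds (log z)) := by
  have h1 : Filter.Tendsto (fun ω : ℝ => z - a * ((ω⁻¹ : ℝ) : ℂ)) Filter.atTop (nhds z) := by
    have h0 : Filter.Tendsto (fun ω : ℝ => ((ω⁻¹ : ℝ) : ℂ)) Filter.atTop (nhds ((0 : ℝ) : ℂ)) :=
      (Complex.continuous_ofReal.tendsto 0).comp tendsto_inv_atTop_zero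
    simpa using (h0.const_mul a).const_sub z
  have h2 := h1.clog hz
  refine h2.congr' ?_
  filter_upwards [Filter.eventually_gt_atTop 0,
    h1.eventually (isOpen_slitPlane.mem_nhds hz)] with ω hω hs
  have hω' : (ω : ℂ) ≠ 0 := by exact_mod_cast hω.ne'
  have : z * ω - a = (ω : ℂ) * (z - a * ((ω⁻¹ : ℝ) : ℂ)) := by
    push_cast; field_simp
  rw [this, Complex.log_ofReal_mul hω (slitPlane_ne_zero hs), Complex.ofReal_log hω.le]
  ring

lemma lim_top {z w : ℂ} (hz : z ∈ slitPlane) (hw : w ∈ slitPlane) (a b : ℂ) :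
    Filter.Tendsto (fun ω : ℝ => log (z * ω - a) - log (w * ω - b)) Filter.atTop
      (nhds (log z - log w)) := by
  refine ((log_lim hz a).sub (log_lim hw b)).congr fun ω => by ring

lemma lim_bot {z w : ℂ} (hz : -z ∈ slitPlane) (hw : -w ∈ slitPlane) (a b : ℂ) :
    Filter.Tendsto (fun ω : ℝ => log (z * ω - a) - log (w * ω - b)) Filter.atBot
      (nhds (log (-z) - log (-w))) := by
  refine ((lim_top hz hw a b).comp Filter.tendsto_neg_atBot_atTop).congr fun ω => ?_
  simp

lemma I_slit : I ∈ slitPlane := by simp [mem_slitPlane_iff]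
lemma nI_slit : -I ∈ slitPlane := by simp [mem_slitPlane_iff]

lemma der_log (z a : ℂ) (ω : ℝ) (h : 0 < (z * ω - a).re) :
    HasDerivAt (fun ω : ℝ => log (z * ω - a)) (z * (z * ω - a)⁻¹) ω := by
  have h1 : HasDerivAt (fun ω : ℝ => z * (ω : ℂ) - a) z ω := by
    simpa using ((HasDerivAt.ofReal_comp (hasDerivAt_id ω)).const_mul z).sub_const a
  have := h1.clog_real (Or.inl h)
  rwa [div_eq_mul_inv] at this

lemma L1 {a b : ℂ} (ha : a.re < 0) (hb : b.re < 0) :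
    HInt (fun ω : ℝ => (-(I * (ω : ℂ)) - b)⁻¹ * (I * (ω : ℂ) - a)⁻¹)
      (2 * Real.pi * (-a - b)⁻¹) := by
  have hi := (memLp_v hb).integrable_mul (memLp_u ha)
  refine ⟨hi, ?_⟩
  have hab : -a - b ≠ 0 := ne_of_re_pos' (by simp; linarith)
  have ht := ((lim_top I_slit nI_slit a b).const_mul ((-a - b)⁻¹ * (-I)))
  have hbo := ((lim_bot (z := I) (w := -I) nI_slit (by simpa using I_slit) a b).const_mul
    ((-a - b)⁻¹ * (-I)))
  have hd : ∀ ω : ℝ, HasDerivAt (fun ω : ℝ => (-a - b)⁻¹ * (-I) *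
      (log (I * ω - a) - log (-I * ω - b)))
      ((-(I * (ω : ℂ)) - b)⁻¹ * (I * (ω : ℂ) - a)⁻¹) ω := by
    intro ω
    have h := ((der_log I a ω (re_u ha ω)).sub
      (der_log (-I) b ω (by simpa using re_v hb ω))).const_mul ((-a - b)⁻¹ * (-I))
    refine HasDerivAt.congr_deriv h (Eq.symm ?_)
    have h1 := ne_of_re_pos' (re_u ha ω)
    have h2 := ne_of_re_pos' (re_v hb ω)
    rw [neg_mul I]
    have : I * (I * ↑ω - a)⁻¹ - -(I * (-(I * ↑ω) - b)⁻¹)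
      = I * ((-a - b) * ((I * ↑ω - a)⁻¹ * (-(I * ↑ω) - b)⁻¹)) := by
      field_simp; ring
    rw [neg_mul I, this]
    have hI : -I * I = 1 := by simp
    calc _ = ((-a-b)⁻¹ * (-a-b)) * (-I * I) * ((I * ↑ω - a)⁻¹ * (-(I * ↑ω) - b)⁻¹) := by
          rw [hI, inv_mul_cancel₀ hab]; ring
      _ = _ := by ring
  rw [integral_of_hasDerivAt_of_tendsto hd hi hbo ht]
  rw [neg_neg, log_I, log_neg_I]
  linear_combination (-2 * Real.pi * (-a-b)⁻¹) * I_sq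

lemma L0 {b c : ℂ} (hb : b.re < 0) (hc : c.re < 0) :
    HInt (fun ω : ℝ => (-(I * (ω : ℂ)) - b)⁻¹ * (-(I * (ω : ℂ)) - c)⁻¹) 0 := by
  have hi := (memLp_v hb).integrable_mul (memLp_v hc)
  refine ⟨hi, ?_⟩
  by_cases hbc : b = c
  · subst hbc
    have hd : ∀ ω : ℝ, HasDerivAt (fun ω : ℝ => (-I) * (-I * (ω : ℂ) - b)⁻¹)
        ((-(I * (ω : ℂ)) - b)⁻¹ * (-(I * (ω : ℂ)) - b)⁻¹) ω := by
      intro ω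
      have h2 := ne_of_re_pos' (re_v hb ω)
      have h1 : HasDerivAt (fun ω : ℝ => -I * (ω : ℂ) - b) (-I) ω := by
        simpa using ((HasDerivAt.ofReal_comp (hasDerivAt_id ω)).const_mul (-I)).sub_const b
      have h := (h1.fun_inv (by simpa using h2)).const_mul (-I)
      refine HasDerivAt.congr_deriv h (Eq.symm ?_)
      rw [neg_mul I]
      field_simp
      simp
    have hn : Filter.Tendsto (fun ω : ℝ => ‖-I * (ω : ℂ) - b‖) (Filter.cocompact ℝ) Filter.atTop := by
      have h0 : Filter.Tendsto (fun ω : ℝ => ‖ω‖ - ‖b‖) (Filter.cocompact ℝ) Filter.atTop :=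
        Filter.tendsto_atTop_add_const_right _ _ (tendsto_norm_cocompact_atTop)
      refine Filter.tendsto_atTop_mono (fun ω => ?_) h0
      have := norm_sub_norm_le (-I * (ω : ℂ)) b
      simpa using this
    have hl : Filter.Tendsto (fun ω : ℝ => (-I) * (-I * (ω : ℂ) - b)⁻¹) (Filter.cocompact ℝ)
        (nhds 0) := by
      have : Filter.Tendsto (fun ω : ℝ => (-I * (ω : ℂ) - b)⁻¹) (Filter.cocompact ℝ)
        (nhds 0) := by
        rw [tendsto_zero_iff_norm_tendsto_zero]
        simp only [norm_inv]
        exact tendsto_inv_atTop_zero.comp hn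
      simpa using this.const_mul (-I)
    have := integral_of_hasDerivAt_of_tendsto hd hi (hl.mono_left atBot_le_cocompact)
      (hl.mono_left atTop_le_cocompact)
    rw [sub_zero] at this
    exact this
  · have hcb : b - c ≠ 0 := sub_ne_zero.mpr hbc
    have ht := ((lim_top nI_slit nI_slit b c).const_mul ((b - c)⁻¹ * I))
    have hbo := ((lim_bot (z := -I) (w := -I) (by simpa using I_slit) (by simpa using I_slit)
      b c).const_mul ((b - c)⁻¹ * I))
    have hd : ∀ ω : ℝ, HasDerivAt (fun ω : ℝ => (b - c)⁻¹ * I *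
        (log (-I * ω - b) - log (-I * ω - c)))
        ((-(I * (ω : ℂ)) - b)⁻¹ * (-(I * (ω : ℂ)) - c)⁻¹) ω := by
      intro ω
      have h := ((der_log (-I) b ω (by simpa using re_v hb ω)).sub
        (der_log (-I) c ω (by simpa using re_v hc ω))).const_mul ((b - c)⁻¹ * I)
      refine HasDerivAt.congr_deriv h (Eq.symm ?_)
      have h1 := ne_of_re_pos' (re_v hb ω)
      have h2 := ne_of_re_pos' (re_v hc ω)
      rw [neg_mul I (ω : ℂ)]
      have : -I * (-(I * ↑ω) - b)⁻¹ - -I * (-(I * ↑ω) - c)⁻¹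
        = -I * ((b - c) * ((-(I * ↑ω) - b)⁻¹ * (-(I * ↑ω) - c)⁻¹)) := by
        field_simp; ring
      rw [this]
      have hI : -I * I = 1 := by simp
      calc _ = ((b-c)⁻¹ * (b-c)) * (-I * I) * ((-(I * ↑ω) - b)⁻¹ * (-(I * ↑ω) - c)⁻¹) := by
            rw [hI, inv_mul_cancel₀ hcb]; ring
        _ = _ := by ring
    have := integral_of_hasDerivAt_of_tendsto hd hi hbo ht
    rw [sub_self, sub_self, sub_self] at this
    exact this

lemma L2 {a b c : ℂ} (ha : a.re < 0) (hb : b.re < 0) (hc : c.re < 0) :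
    HInt (fun ω : ℝ => (-(I * (ω : ℂ)) - b)⁻¹ * (-(I * (ω : ℂ)) - c)⁻¹ * (I * (ω : ℂ) - a)⁻¹)
      (2 * Real.pi * ((-a - b)⁻¹ * (-a - c)⁻¹)) := by
  have h := ((L1 ha hb).add (L0 hb hc)).mul (-a - c)⁻¹
  convert h using 1
  · funext ω
    have hac : -a - c ≠ 0 := ne_of_re_pos' (by simp; linarith)
    have h1 := ne_of_re_pos' (re_v hb ω)
    have h2 := ne_of_re_pos' (re_v hc ω)
    have h3 := ne_of_re_pos' (re_u ha ω)
    field_simp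
    ring
  · ring

theorem weighted_inner_product_simple_kernel
    {n p : ℕ} (lam : Fin n → ℂ) (gam : Fin p → ℂ) (φ : Fin n → ℂ) (ρ : Fin p → ℂ)
    (winf : ℂ) (G W F : ℂ → ℂ) (μ : ℂ)
    (hG : G = fun s => ∑ i, φ i / (s - lam i))
    (hW : W = fun s => winf + ∑ k, ρ k / (s - gam k))
    (hF : F = fun s => G s * W s * W (-s)
        + ∑ k, G (-(gam k)) * W (-(gam k)) * ρ k / (s + gam k))
    (hlam : ∀ i, (lam i).re < 0) (hgam : ∀ k, (gam k).re < 0)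
    (hlam_inj : Function.Injective lam) (hgam_inj : Function.Injective gam)
    (hμ : μ.re < 0)
    (hμlam : ∀ i, μ ≠ lam i) (hμgam : ∀ k, μ ≠ gam k)
    (hμlam' : ∀ i, μ ≠ -(lam i)) (hμgam' : ∀ k, μ ≠ -(gam k)) :
    (2 * (Real.pi : ℂ))⁻¹ *
        ∫ ω : ℝ, G (-(Complex.I * (ω : ℂ))) * W (-(Complex.I * (ω : ℂ))) *
          W (Complex.I * (ω : ℂ)) * (Complex.I * (ω : ℂ) - μ)⁻¹
      = F (-μ) := by
  have key : ∀ a : ℂ, a.re < 0 → HInt (fun ω : ℝ => G (-(I * (ω : ℂ))) * W (-(I * (ω : ℂ))) *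
      (I * (ω : ℂ) - a)⁻¹) (2 * Real.pi * (G (-a) * W (-a))) := by
    intro a ha
    have h := HInt.sum Finset.univ (fun i => (((L1 ha (hlam i)).mul winf).add
      (HInt.sum Finset.univ (fun k => (L2 ha (hlam i) (hgam k)).mul (ρ k)))).mul (φ i))
    convert h using 1
    · funext ω
      simp only [hG, hW]
      rw [Finset.sum_mul, Finset.sum_mul]
      refine Finset.sum_congr rfl fun i _ => ?_
      rw [mul_add, add_mul, mul_add, Finset.mul_sum, Finset.mul_sum, Finset.sum_mul]
      congr 1
      · ring
      · refine Finset.sum_congr rfl fun k _ => ?_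
        ring
    · simp only [hG, hW]
      rw [Finset.sum_mul, Finset.mul_sum]
      refine Finset.sum_congr rfl fun i _ => ?_
      rw [mul_add, mul_add, mul_add, Finset.mul_sum, Finset.mul_sum, Finset.mul_sum]
      congr 1
      · ring
      · refine Finset.sum_congr rfl fun k _ => ?_
        ring
  have h := ((key μ hμ).mul (W μ)).add (HInt.sum Finset.univ
    (fun k => (key (gam k) (hgam k)).mul (ρ k / (gam k - μ))))
  have hfun : (fun ω : ℝ => G (-(I * (ω : ℂ))) * W (-(I * (ω : ℂ))) *
          W (I * (ω : ℂ)) * (I * (ω : ℂ) - μ)⁻¹) = (fun ω : ℝ =>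
      W μ * (G (-(I * (ω : ℂ))) * W (-(I * (ω : ℂ))) * (I * (ω : ℂ) - μ)⁻¹) +
      ∑ k, ρ k / (gam k - μ) * (G (-(I * (ω : ℂ))) * W (-(I * (ω : ℂ))) *
        (I * (ω : ℂ) - gam k)⁻¹)) := by
    funext ω
    have hpf : W (I * (ω : ℂ)) * (I * (ω : ℂ) - μ)⁻¹ = W μ * (I * (ω : ℂ) - μ)⁻¹ +
        ∑ k, ρ k / (gam k - μ) * (I * (ω : ℂ) - gam k)⁻¹ := by
      simp only [hW]
      rw [add_mul, add_mul, add_assoc, Finset.sum_mul, Finset.sum_mul, ← Finset.sum_add_distrib]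
      congr 1
      refine Finset.sum_congr rfl fun k _ => ?_
      have h1 := ne_of_re_pos' (re_u hμ ω)
      have h2 := ne_of_re_pos' (re_u (hgam k) ω)
      have h3 : gam k - μ ≠ 0 := sub_ne_zero.mpr (hμgam k).symm
      have h4 : μ - gam k = -(gam k - μ) := by ring
      rw [h4]
      field_simp
      ring
    rw [mul_assoc, hpf, mul_add, Finset.mul_sum]
    congr 1
    · ring
    · refine Finset.sum_congr rfl fun k _ => ?_
      ring
  rw [hfun, h.2]
  have hpi : (2 * (Real.pi : ℂ)) ≠ 0 := by simp [Real.pi_ne_zero]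
  have e : (W μ * (2 * ↑Real.pi * (G (-μ) * W (-μ))) +
      ∑ k, ρ k / (gam k - μ) * (2 * ↑Real.pi * (G (-gam k) * W (-gam k))))
      = (2 * (Real.pi : ℂ)) * F (-μ) := by
    simp only [hF]
    rw [mul_add, Finset.mul_sum, neg_neg]
    congr 1
    · ring
    · refine Finset.sum_congr rfl fun k _ => ?_
      rw [neg_add_eq_sub]
      ring
  rw [e, inv_mul_cancel_left₀ hpi]
end

section
/- In the setting of the previous corollary (G, W rational with simple stable poles, μ stable and distinct from all poles and their reflections, F = 𝔉[G]), one has ⟨G, 1/(s − μ)²⟩_{H2(W)} = −F′(−μ). -/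
open MeasureTheory Complex
section Helpers
open Filter Bornology Asymptotics Topology

lemma wk_line (K : ℂ → ℂ) (hK : ContinuousOn K {s | s.re = 0})
    (hO : K =O[cobounded ℂ] (fun s => (s^2)⁻¹)) :
    Integrable (fun ω : ℝ => K (I * (ω : ℂ))) := by
  have hc : Continuous (fun ω : ℝ => K (I * (ω : ℂ))) :=
    hK.comp_continuous (by fun_prop) (by intro x; simp)
  have ht : Tendsto (fun ω : ℝ => I * (ω : ℂ)) (cocompact ℝ) (cobounded ℂ) := by
    rw [← Metric.cobounded_eq_cocompact, ← tendsto_norm_atTop_iff_cobounded]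
    refine (tendsto_norm_cobounded_atTop (E := ℝ)).congr fun x => ?_
    simp
  have h1 := hO.comp_tendsto ht
  refine hc.locallyIntegrable.integrable_of_isBigO_cocompact (g := fun ω : ℝ => (1 + ω^2)⁻¹) (h1.trans ?_) (integrable_inv_one_add_sq.integrableAtFilter _)
  refine IsBigO.of_bound 2 ?_
  have : ∀ᶠ ω : ℝ in cocompact ℝ, 1 ≤ ‖ω‖ := by
    rw [← Metric.cobounded_eq_cocompact]
    exact tendsto_norm_cobounded_atTop.eventually_ge_atTop 1
  filter_upwards [this] with ω hω
  have h2 : 1 ≤ ω^2 := by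
    rw [← sq_abs]; rw [Real.norm_eq_abs] at hω; nlinarith
  simp only [Function.comp, norm_inv, norm_pow, norm_mul, norm_I, one_mul, Complex.norm_real, Real.norm_eq_abs, sq_abs]
  rw [abs_of_pos (by positivity : 0 < 1 + ω^2), ← div_eq_mul_inv, inv_le_comm₀ (by positivity) (by positivity)]
  rw [inv_div]; linarith

lemma wk_left (K : ℂ → ℂ) (hK : DifferentiableOn ℂ K {s | s.re ≤ 0})
    (hO : K =O[cobounded ℂ] (fun s => (s^2)⁻¹)) :
    ∫ ω : ℝ, K (I * (ω : ℂ)) = 0 := by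
  have hint := wk_line K (hK.continuousOn.mono (fun s (hs : s.re = 0) => hs.le)) hO
  have hlim := intervalIntegral_tendsto_integral hint tendsto_neg_atTop_atBot tendsto_id
  refine tendsto_nhds_unique hlim ?_
  obtain ⟨C, hC⟩ := hO.bound
  obtain ⟨M, -, hM⟩ := (hasBasis_cobounded_norm (E := ℂ)).eventually_iff.1 hC
  rw [tendsto_zero_iff_norm_tendsto_zero]
  have hz : Tendsto (fun T : ℝ => 4 * C * T⁻¹) atTop (𝓝 0) := by
    simpa using tendsto_inv_atTop_zero.const_mul (4*C)
  refine squeeze_zero' (Eventually.of_forall fun _ => norm_nonneg _) ?_ hz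
  filter_upwards [eventually_ge_atTop (max M 1)] with T hT
  have hTM : M ≤ T := (le_max_left _ _).trans hT
  have hT1 : 1 ≤ T := (le_max_right _ _).trans hT
  have hT0 : 0 < T := by linarith
  have hb : ∀ s : ℂ, T ≤ ‖s‖ → ‖K s‖ ≤ C * (T^2)⁻¹ := by
    intro s hs
    have h1 := hM (show M ≤ ‖s‖ from hTM.trans hs)
    have hC0 : 0 ≤ C := by
      have h3 : 0 < ‖(s^2)⁻¹‖ := by
        rw [norm_inv, norm_pow]; have : 0 < ‖s‖ := by linarith
        positivity
      by_contra hneg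
      have := norm_nonneg (K s)
      nlinarith
    refine h1.trans ?_
    rw [norm_inv, norm_pow]
    gcongr
  have hrect := Complex.integral_boundary_rect_eq_zero_of_differentiableOn K (⟨-T, -T⟩) (⟨0, T⟩) (hK.mono (by
    intro s hs
    have := hs.1
    simp only [Set.mem_preimage] at this
    rw [Set.uIcc_of_le (by linarith)] at this
    exact this.2))
  simp only at hrect
  have e1 : (∫ y in (-T)..T, K ((0:ℝ) + y * I)) = ∫ x in (-T)..T, K (I * x) := by
    congr 1; ext y; simp [mul_comm]
  rw [e1] at hrect
  have b1 : ‖∫ x in (-T)..0, K (x + ((-T : ℝ):ℂ) * I)‖ ≤ C * (T^2)⁻¹ * |0 - (-T)| := by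
    refine intervalIntegral.norm_integral_le_of_norm_le_const fun x _ => hb _ ?_
    refine le_trans ?_ (abs_im_le_norm _)
    simp [abs_of_pos hT0]
  have b2 : ‖∫ x in (-T)..0, K (x + ((T : ℝ):ℂ) * I)‖ ≤ C * (T^2)⁻¹ * |0 - (-T)| := by
    refine intervalIntegral.norm_integral_le_of_norm_le_const fun x _ => hb _ ?_
    refine le_trans ?_ (abs_im_le_norm _)
    simp [abs_of_pos hT0]
  have b3 : ‖∫ y in (-T)..T, K (((-T:ℝ):ℂ) + y * I)‖ ≤ C * (T^2)⁻¹ * |T - (-T)| := by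
    refine intervalIntegral.norm_integral_le_of_norm_le_const fun x _ => hb _ ?_
    refine le_trans ?_ (abs_re_le_norm _)
    simp [abs_of_pos hT0]
  rw [abs_of_pos (by linarith)] at b1 b2 b3
  set A := ∫ x in (-T)..0, K (x + ((-T : ℝ):ℂ) * I)
  set B := ∫ x in (-T)..0, K (x + ((T : ℝ):ℂ) * I)
  set D := ∫ y in (-T)..T, K (((-T:ℝ):ℂ) + y * I)
  simp only [id]
  set E := ∫ x in (-T)..T, K (I * x)
  have hE : I * E = B - A + I * D := by
    simp only [smul_eq_mul] at hrect; linear_combination hrect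
  have : ‖E‖ ≤ ‖B‖ + ‖A‖ + ‖D‖ := by
    calc ‖E‖ = ‖I * E‖ := by simp
      _ = ‖B - A + I * D‖ := by rw [hE]
      _ ≤ ‖B - A‖ + ‖I * D‖ := norm_add_le _ _
      _ ≤ ‖B‖ + ‖A‖ + ‖D‖ := by
        have := norm_sub_le B A
        simp only [norm_mul, norm_I, one_mul]; linarith
  have e : 4 * C * T⁻¹ = C * (T^2)⁻¹ * (0 - (-T)) + C * (T^2)⁻¹ * (0 - (-T)) + C * (T^2)⁻¹ * (T - (-T)) := by
    field_simp; ring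
  rw [e]; linarith

lemma wk_right (K : ℂ → ℂ) (hK : DifferentiableOn ℂ K {s | 0 ≤ s.re})
    (hO : K =O[cobounded ℂ] (fun s => (s^2)⁻¹)) :
    ∫ ω : ℝ, K (I * (ω : ℂ)) = 0 := by
  have h := wk_left (fun s => K (-s)) (hK.comp (by fun_prop) (by intro s hs; simpa using hs))
    (by
      have := hO.comp_tendsto (k := fun s : ℂ => -s) (l' := cobounded ℂ) tendsto_neg_cobounded
      refine this.congr (fun _ => rfl) (fun _ => by simp))
  rw [← integral_neg_eq_self] at h
  simpa using h

lemma wk_O (a : ℂ) : (fun s : ℂ => (s - a)⁻¹) =O[cobounded ℂ] (fun s => s⁻¹) := by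
  have h : (fun s : ℂ => s) =O[cobounded ℂ] (fun s => s - a) := by
    refine IsBigO.of_bound 2 ?_
    filter_upwards [tendsto_norm_cobounded_atTop.eventually_ge_atTop (2 * ‖a‖)] with s hs
    have := norm_sub_norm_le s a
    linarith
  refine h.inv_rev ?_
  filter_upwards [tendsto_norm_cobounded_atTop.eventually_ge_atTop 1] with s hs h0
  rw [h0] at hs; simp at hs; linarith

lemma wk_O0 (a : ℂ) : (fun s : ℂ => (s - a)⁻¹) =O[cobounded ℂ] (fun _ => (1:ℂ)) := by
  refine (wk_O a).trans (IsBigO.of_bound 1 ?_)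
  filter_upwards [tendsto_norm_cobounded_atTop.eventually_ge_atTop 1] with s hs
  rw [norm_inv]; simpa using inv_le_one_of_one_le₀ hs

lemma wk_dslope (H : ℂ → ℂ) (c : ℂ) (hO : H =O[cobounded ℂ] (fun s => s⁻¹)) :
    dslope H c =O[cobounded ℂ] (fun s => s⁻¹) := by
  have h1 : H =O[cobounded ℂ] (fun _ => (1:ℂ)) := hO.trans (by simpa using wk_O0 0)
  have h2 : (fun s => (s - c)⁻¹ * (H s - H c)) =O[cobounded ℂ] (fun s => s⁻¹ * (1:ℂ)) :=
    (wk_O c).mul (h1.sub (isBigO_const_const _ one_ne_zero _))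
  refine h2.congr' ?_ (by simp)
  filter_upwards [tendsto_norm_cobounded_atTop.eventually_gt_atTop ‖c‖] with s hs
  have : s ≠ c := by rintro rfl; exact lt_irrefl _ hs
  rw [dslope_of_ne _ this, slope_def_field, div_eq_inv_mul]

lemma wk_nhds {c : ℂ} (hc : c.re < 0) : {s : ℂ | s.re ≤ 0} ∈ 𝓝 c :=
  mem_of_superset ((isOpen_lt continuous_re continuous_const).mem_nhds hc)
    (fun s (hs : s.re < 0) => hs.le)

lemma wk_inv_right {a : ℂ} (ha : a.re < 0) : DifferentiableOn ℂ (fun s => (s - a)⁻¹) {s | 0 ≤ s.re} := by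
  intro s hs
  have : s - a ≠ 0 := by
    intro h; rw [sub_eq_zero] at h; subst h; exact absurd ha (not_lt.2 hs)
  fun_prop (disch := assumption)

lemma wk_inv_left {a : ℂ} (ha : 0 < a.re) : DifferentiableOn ℂ (fun s => (s - a)⁻¹) {s | s.re ≤ 0} := by
  intro s hs
  have : s - a ≠ 0 := by
    intro h; rw [sub_eq_zero] at h; subst h; exact absurd ha (not_lt.2 hs)
  fun_prop (disch := assumption)

lemma wk_base {c : ℂ} (hc : c.re < 0) :
    ∫ ω : ℝ, ((I * ω - c)⁻¹ - (I * ω - 1)⁻¹) = 2 * Real.pi := by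
  have hdiff : ∀ a b : ℂ, (fun s : ℂ => (a - b) * ((s - a)⁻¹ * (s - b)⁻¹)) =O[cobounded ℂ] (fun s => (s^2)⁻¹) := by
    intro a b
    refine (((wk_O a).mul (wk_O b)).const_mul_left _).congr (fun _ => rfl) (fun s => by simp [sq])
  have d1 := wk_right (fun s => (c - (-1)) * ((s - c)⁻¹ * (s - (-1))⁻¹))
    (((wk_inv_right hc).mul (wk_inv_right (by simp))).const_mul _) (hdiff _ _)
  have i1 := wk_line (fun s => (c - (-1)) * ((s - c)⁻¹ * (s - (-1))⁻¹))
    ((((wk_inv_right hc).mul (wk_inv_right (by simp))).const_mul _).continuousOn.mono (fun s (hs : s.re = 0) => hs.ge)) (hdiff _ _)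
  have i2 : Integrable (fun ω : ℝ => (((2 * (1 + ω^2)⁻¹ : ℝ)) : ℂ)) :=
    (integrable_inv_one_add_sq.const_mul 2).ofReal
  have e : ∀ ω : ℝ, (I * ω - c)⁻¹ - (I * ω - 1)⁻¹ =
     (c - (-1)) * ((I * ω - c)⁻¹ * (I * ω - (-1))⁻¹) + (((2 * (1 + ω^2)⁻¹ : ℝ)) : ℂ) := by
    intro ω
    have h1 : I * (ω:ℂ) - c ≠ 0 := by
      intro h; have := congrArg re h; simp at this; linarith
    have h2 : I * (ω:ℂ) - 1 ≠ 0 := by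
      intro h; have := congrArg re h; simp at this
    have h3 : I * (ω:ℂ) - (-1) ≠ 0 := by
      intro h; have := congrArg re h; simp at this
    have h4 : (1 + (ω:ℂ)^2) = -((I * (ω:ℂ) - 1) * (I * (ω:ℂ) - (-1))) := by
      linear_combination ((ω:ℂ)^2) * I_sq
    push_cast
    rw [h4]
    field_simp
    ring
  simp_rw [e]
  rw [integral_add i1 i2, d1, integral_complex_ofReal, integral_const_mul, integral_univ_inv_one_add_sq]
  push_cast; ring

lemma wk_ne {c : ℂ} (hc : c.re < 0) (ω : ℝ) : I * (ω:ℂ) - c ≠ 0 := by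
  intro h; have := congrArg re h; simp at this; linarith

lemma wk_axis {c : ℂ} (hc : c.re < 0) : ContinuousOn (fun s => (s - c)⁻¹) {s | s.re = 0} :=
  (wk_inv_right hc).continuousOn.mono (fun s (hs : s.re = 0) => hs.ge)

lemma wk_sub (H : ℂ → ℂ) (c : ℂ) (s : ℂ) : H s = H c + (s - c) * dslope H c s := by
  have := sub_smul_dslope H c s
  simp only [smul_eq_mul] at this
  linear_combination -this

lemma wk_cauchy (H : ℂ → ℂ) (hH : DifferentiableOn ℂ H {s | s.re ≤ 0})
    (hO : H =O[cobounded ℂ] (fun s => s⁻¹)) {c : ℂ} (hc : c.re < 0) :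
    Integrable (fun ω : ℝ => H (I * ω) * (I * ω - c)⁻¹) ∧
    ∫ ω : ℝ, H (I * ω) * (I * ω - c)⁻¹ = 2 * Real.pi * H c := by
  have hq : (fun s => H s * (s - c)⁻¹) =O[cobounded ℂ] (fun s => (s^2)⁻¹) :=
    (hO.mul (wk_O c)).congr (fun _ => rfl) (fun s => by simp [sq])
  have hcont := hH.continuousOn.mono (fun s (hs : s.re = 0) => hs.le)
  have hi := wk_line (fun s => H s * (s - c)⁻¹) (hcont.mul (wk_axis hc)) hq
  refine ⟨hi, ?_⟩
  have hD : DifferentiableOn ℂ (dslope H c) {s | s.re ≤ 0} :=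
    (Complex.differentiableOn_dslope (wk_nhds hc)).2 hH
  have hdO : (fun s => dslope H c s + H c * (s - 1)⁻¹) =O[cobounded ℂ] (fun s => (s^2)⁻¹) := by
    have h2 : (fun s => H s * (s - c)⁻¹ - H c * ((c - 1) * ((s - c)⁻¹ * (s - 1)⁻¹))) =O[cobounded ℂ] (fun s => (s^2)⁻¹) := by
      refine hq.sub ?_
      refine ((((wk_O c).mul (wk_O 1)).const_mul_left _).const_mul_left _).congr (fun _ => rfl) (fun s => by simp [sq])
    refine h2.congr' ?_ EventuallyEq.rfl
    filter_upwards [tendsto_norm_cobounded_atTop.eventually_gt_atTop ‖c‖, tendsto_norm_cobounded_atTop.eventually_gt_atTop 1] with s hs hs1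
    have h1 : s - c ≠ 0 := by rw [sub_ne_zero]; rintro rfl; exact lt_irrefl _ hs
    have h2 : s - 1 ≠ 0 := by rw [sub_ne_zero]; rintro rfl; simp at hs1
    rw [wk_sub H c s]
    field_simp
    ring
  have hdd : DifferentiableOn ℂ (fun s => dslope H c s + H c * (s - 1)⁻¹) {s | s.re ≤ 0} :=
    hD.add ((wk_inv_left (by simp)).const_mul _)
  have z := wk_left _ hdd hdO
  have iz := wk_line _ (hdd.continuousOn.mono (fun s (hs : s.re = 0) => hs.le)) hdO
  have e : ∀ ω : ℝ, dslope H c (I * ω) + H c * (I * ω - 1)⁻¹ = H (I * ω) * (I * ω - c)⁻¹ -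
     H c * ((I * ω - c)⁻¹ - (I * ω - 1)⁻¹) := by
    intro ω
    have h1 := wk_ne hc ω
    rw [wk_sub H c (I * ω)]
    field_simp
    ring
  have ib : Integrable (fun ω : ℝ => H c * ((I * ω - c)⁻¹ - (I * ω - 1)⁻¹)) := by
    refine (hi.sub iz).congr (Eventually.of_forall fun ω => ?_)
    simp only [Pi.sub_apply]
    rw [e]; ring
  simp_rw [e] at z
  rw [integral_sub hi ib, integral_const_mul, wk_base hc] at z
  linear_combination z

lemma wk_A (H : ℂ → ℂ) (hH : DifferentiableOn ℂ H {s | s.re ≤ 0})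
    (hO : H =O[cobounded ℂ] (fun s => s⁻¹)) {c : ℂ} (hc : c.re < 0) :
    Integrable (fun ω : ℝ => H (I * ω) * ((I * ω - c)^2)⁻¹) ∧
    ∫ ω : ℝ, H (I * ω) * ((I * ω - c)^2)⁻¹ = 2 * Real.pi * deriv H c := by
  have hD : DifferentiableOn ℂ (dslope H c) {s | s.re ≤ 0} :=
    (Complex.differentiableOn_dslope (wk_nhds hc)).2 hH
  obtain ⟨i1, v1⟩ := wk_cauchy _ hD (wk_dslope H c hO) hc
  have hq : (fun s => H c * ((s - c)⁻¹ * (s - c)⁻¹)) =O[cobounded ℂ] (fun s => (s^2)⁻¹) :=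
    (((wk_O c).mul (wk_O c)).const_mul_left _).congr (fun _ => rfl) (fun s => by simp [sq])
  have i2 := wk_line _ (((wk_axis hc).mul (wk_axis hc)).const_mul (H c)) hq
  have v2 := wk_right _ (((wk_inv_right hc).mul (wk_inv_right hc)).const_mul (H c)) hq
  simp only [Pi.mul_apply] at i2 v2
  have e : ∀ ω : ℝ, H (I * ω) * ((I * ω - c)^2)⁻¹ = dslope H c (I * ω) * (I * ω - c)⁻¹ +
     H c * ((I * ω - c)⁻¹ * (I * ω - c)⁻¹) := by
    intro ω
    have h1 := wk_ne hc ω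
    rw [wk_sub H c (I * ω)]
    field_simp
    ring
  simp_rw [e]
  refine ⟨i1.add i2, ?_⟩
  rw [integral_add i1 i2, v1, v2, dslope_same, add_zero]

lemma wk_B (H : ℂ → ℂ) (hH : DifferentiableOn ℂ H {s | s.re ≤ 0})
    (hO : H =O[cobounded ℂ] (fun s => s⁻¹)) {c g : ℂ} (hc : c.re < 0) (hg : g.re < 0) (hne : c ≠ g) :
    Integrable (fun ω : ℝ => H (I * ω) * ((I * ω - g)⁻¹ * ((I * ω - c)^2)⁻¹)) ∧
    ∫ ω : ℝ, H (I * ω) * ((I * ω - g)⁻¹ * ((I * ω - c)^2)⁻¹) =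
      2 * Real.pi * (deriv H c / (c - g) - (H c - H g) / (c - g)^2) := by
  have hD : DifferentiableOn ℂ (dslope H g) {s | s.re ≤ 0} :=
    (Complex.differentiableOn_dslope (wk_nhds hg)).2 hH
  obtain ⟨i1, v1⟩ := wk_A _ hD (wk_dslope H g hO) hc
  have hq : (fun s => H g * ((s - g)⁻¹ * ((s - c)⁻¹ * (s - c)⁻¹))) =O[cobounded ℂ] (fun s => (s^2)⁻¹) :=
    (((wk_O0 g).mul ((wk_O c).mul (wk_O c))).const_mul_left _).congr (fun _ => rfl) (fun s => by simp [sq])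
  have i2 := wk_line _ (((wk_axis hg).mul ((wk_axis hc).mul (wk_axis hc))).const_mul (H g)) hq
  have v2 := wk_right _ (((wk_inv_right hg).mul ((wk_inv_right hc).mul (wk_inv_right hc))).const_mul (H g)) hq
  simp only [Pi.mul_apply] at i2 v2
  have e : ∀ ω : ℝ, H (I * ω) * ((I * ω - g)⁻¹ * ((I * ω - c)^2)⁻¹) = dslope H g (I * ω) * ((I * ω - c)^2)⁻¹ +
     H g * ((I * ω - g)⁻¹ * ((I * ω - c)⁻¹ * (I * ω - c)⁻¹)) := by
    intro ω
    have h1 := wk_ne hc ω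
    have h2 := wk_ne hg ω
    rw [wk_sub H g (I * ω)]
    field_simp
    ring
  have hd : deriv (dslope H g) c = deriv H c / (c - g) - (H c - H g) / (c - g)^2 := by
    have h0 : c - g ≠ 0 := sub_ne_zero.2 hne
    have : dslope H g =ᶠ[𝓝 c] fun s => (H s - H g) / (s - g) := by
      filter_upwards [isOpen_ne.mem_nhds hne] with s hs
      rw [dslope_of_ne _ hs, slope_def_field]
    rw [this.deriv_eq]
    have hHc : HasDerivAt H (deriv H c) c := (hH.differentiableAt (wk_nhds hc)).hasDerivAt
    rw [((hHc.sub_const (H g)).fun_div ((hasDerivAt_id' c).sub_const g) h0).deriv]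
    field_simp
  simp_rw [e]
  refine ⟨i1.add i2, ?_⟩
  rw [integral_add i1 i2, v1, v2, hd, add_zero]

lemma wk_total {p : ℕ} (gam : Fin p → ℂ) (ρ : Fin p → ℂ) (winf : ℂ) (H : ℂ → ℂ)
    (hH : DifferentiableOn ℂ H {s | s.re ≤ 0})
    (hO : H =O[cobounded ℂ] (fun s => s⁻¹)) {c : ℂ} (hc : c.re < 0)
    (hgam : ∀ k, (gam k).re < 0) (hne : ∀ k, c ≠ gam k) :
    ∫ ω : ℝ, H (I * ω) * (winf + ∑ k, ρ k / (I * ω - gam k)) * ((I * ω - c)^2)⁻¹ =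
      2 * Real.pi * (winf * deriv H c + ∑ k, ρ k *
        (deriv H c / (c - gam k) - (H c - H (gam k)) / (c - gam k)^2)) := by
  obtain ⟨i1, v1⟩ := wk_A H hH hO hc
  have hB := fun k => wk_B H hH hO hc (hgam k) (hne k)
  have e : ∀ ω : ℝ, H (I * ω) * (winf + ∑ k, ρ k / (I * ω - gam k)) * ((I * ω - c)^2)⁻¹ =
      winf * (H (I * ω) * ((I * ω - c)^2)⁻¹) +
        ∑ k, ρ k * (H (I * ω) * ((I * ω - gam k)⁻¹ * ((I * ω - c)^2)⁻¹)) := by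
    intro ω
    rw [mul_add, add_mul, Finset.mul_sum, Finset.sum_mul]
    congr 1
    · ring
    · refine Finset.sum_congr rfl fun k _ => ?_
      rw [div_eq_mul_inv]; ring
  simp_rw [e]
  rw [integral_add (i1.const_mul _) (integrable_finsetSum _ fun k _ => (hB k).1.const_mul _),
    integral_finsetSum _ (fun k _ => (hB k).1.const_mul _), integral_const_mul, v1]
  simp_rw [integral_const_mul, fun k => (hB k).2]
  rw [mul_add, Finset.mul_sum]
  congr 1
  · ring
  · refine Finset.sum_congr rfl fun k _ => ?_
    ring

lemma wk_neg_diff {n : ℕ} (lam φ : Fin n → ℂ) (hlam : ∀ i, (lam i).re < 0) :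
    DifferentiableOn ℂ (fun s => ∑ i, φ i / (-s - lam i)) {s | s.re ≤ 0} := by
  refine DifferentiableOn.fun_sum fun i _ => ?_
  intro s hs
  have : -s - lam i ≠ 0 := by
    intro h
    have h2 := congrArg re h
    have h3 := hlam i
    simp at h2
    have h4 : s.re ≤ 0 := hs
    linarith
  fun_prop (disch := assumption)

lemma wk_neg_O {n : ℕ} (lam φ : Fin n → ℂ) :
    (fun s => ∑ i, φ i / (-s - lam i)) =O[cobounded ℂ] (fun s => s⁻¹) := by
  refine IsBigO.fun_sum fun i _ => ?_
  refine ((wk_O (-lam i)).const_mul_left (-φ i)).congr (fun s => ?_) (fun _ => rfl)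
  rw [show -s - lam i = -(s - -lam i) by ring, div_neg, div_eq_mul_inv]
  ring

end Helpers

/-- Corollary `ElemOrthCond`, second part: with `F = 𝔉[G]`,
`⟨G, 1/(s-μ)²⟩_{H2(W)} = -F'(-μ)` for any stable `μ` distinct from all poles of
`G`, `W` and their reflections. -/
theorem weighted_inner_product_double_kernel
    {n p : ℕ} (lam : Fin n → ℂ) (gam : Fin p → ℂ) (φ : Fin n → ℂ) (ρ : Fin p → ℂ)
    (winf : ℂ) (G W F : ℂ → ℂ) (μ : ℂ)
    (hG : G = fun s => ∑ i, φ i / (s - lam i))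
    (hW : W = fun s => winf + ∑ k, ρ k / (s - gam k))
    (hF : F = fun s => G s * W s * W (-s)
        + ∑ k, G (-(gam k)) * W (-(gam k)) * ρ k / (s + gam k))
    (hlam : ∀ i, (lam i).re < 0) (hgam : ∀ k, (gam k).re < 0)
    (hlam_inj : Function.Injective lam) (hgam_inj : Function.Injective gam)
    (hμ : μ.re < 0)
    (hμlam : ∀ i, μ ≠ lam i) (hμgam : ∀ k, μ ≠ gam k)
    (hμlam' : ∀ i, μ ≠ -(lam i)) (hμgam' : ∀ k, μ ≠ -(gam k)) :
    (2 * (Real.pi : ℂ))⁻¹ *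
        ∫ ω : ℝ, G (-(Complex.I * (ω : ℂ))) * W (-(Complex.I * (ω : ℂ))) *
          W (Complex.I * (ω : ℂ)) * ((Complex.I * (ω : ℂ) - μ) ^ 2)⁻¹
      = -(deriv F (-μ)) := by
  have hsmall : ∀ {p : ℕ} (g r : Fin p → ℂ), (fun s => ∑ i, r i / (-s - g i)) =O[Bornology.cobounded ℂ]
      (fun _ => (1:ℂ)) := fun g r => (wk_neg_O g r).trans (by simpa using wk_O0 0)
  obtain ⟨H, hHdef⟩ : ∃ H : ℂ → ℂ, H = fun s => G (-s) * W (-s) := ⟨_, rfl⟩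
  have hH : DifferentiableOn ℂ H {s | s.re ≤ 0} := by
    rw [hHdef, hG, hW]
    exact (wk_neg_diff lam φ hlam).fun_mul ((wk_neg_diff gam ρ hgam).const_add winf)
  have hO : H =O[Bornology.cobounded ℂ] (fun s => s⁻¹) := by
    rw [hHdef, hG, hW]
    refine ((wk_neg_O lam φ).mul ((Asymptotics.isBigO_const_const winf (one_ne_zero (α := ℂ)) _).add
      (hsmall gam ρ))).congr (fun _ => rfl) (fun s => by simp)
  have key := wk_total gam ρ winf H hH hO hμ hgam hμgam
  have hHμ : HasDerivAt H (deriv H μ) μ := (hH.differentiableAt (wk_nhds hμ)).hasDerivAt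
  have hWμ : HasDerivAt W (∑ k, -(ρ k) / (μ - gam k)^2) μ := by
    rw [hW]
    refine (HasDerivAt.fun_sum fun k _ => ?_).const_add winf
    have h0 : μ - gam k ≠ 0 := sub_ne_zero.2 (hμgam k)
    have := (hasDerivAt_const μ (ρ k)).fun_div ((hasDerivAt_id' μ).sub_const (gam k)) h0
    refine this.congr_deriv ?_
    ring
  have hFe : F = fun s => H (-s) * W (-s) + ∑ k, H (gam k) * ρ k / (s + gam k) := by
    rw [hF, hHdef]; simp
  have hFd : HasDerivAt F (-(deriv H μ * W μ + H μ * ∑ k, -(ρ k) / (μ - gam k)^2)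
      + ∑ k, -(H (gam k) * ρ k) / (-μ + gam k)^2) (-μ) := by
    rw [hFe]
    refine HasDerivAt.fun_add ?_ (HasDerivAt.fun_sum fun k _ => ?_)
    · have h1 : HasDerivAt (fun s => H s * W s)
        (deriv H μ * W μ + H μ * ∑ k, -(ρ k) / (μ - gam k)^2) (-(-μ)) := by
        rw [neg_neg]; exact hHμ.fun_mul hWμ
      exact (h1.comp (-μ) (hasDerivAt_neg (-μ))).congr_deriv (by ring)
    · have h0 : -μ + gam k ≠ 0 := by
        intro h; apply hμgam k; linear_combination -h
      have := (hasDerivAt_const (-μ) (H (gam k) * ρ k)).fun_div ((hasDerivAt_id' (-μ)).add_const (gam k)) h0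
      refine this.congr_deriv ?_
      ring
  have hint : (∫ ω : ℝ, G (-(Complex.I * (ω : ℂ))) * W (-(Complex.I * (ω : ℂ))) *
          W (Complex.I * (ω : ℂ)) * ((Complex.I * (ω : ℂ) - μ) ^ 2)⁻¹) =
      ∫ ω : ℝ, H (I * ω) * (winf + ∑ k, ρ k / (I * ω - gam k)) * ((I * ω - μ)^2)⁻¹ := by
    congr 1; ext ω
    rw [hHdef, hW]
  have hpi : (2 * (Real.pi : ℂ)) ≠ 0 := by
    simp [Real.pi_ne_zero]
  rw [hint, key, hFd.deriv, inv_mul_cancel_left₀ hpi]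
  have hWv : W μ = winf + ∑ k, ρ k / (μ - gam k) := by rw [hW]
  rw [hWv]
  simp only [mul_add, Finset.mul_sum, neg_add, neg_neg]
  rw [← Finset.sum_neg_distrib, add_assoc, add_assoc, ← Finset.sum_add_distrib, ← Finset.sum_add_distrib]
  congr 1
  · ring
  · refine Finset.sum_congr rfl fun k _ => ?_
    have h0 : μ - gam k ≠ 0 := sub_ne_zero.2 (hμgam k)
    rw [show (-μ + gam k)^2 = (μ - gam k)^2 by ring]
    field_simp
    ring
end
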